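/- arXiv:1605.01267 — 6 statements merged into one kernel-verified Lean document; each statement's English description precedes it below -/
import Mathlib

section
/- For all vectors x, y, z in ℝ⁷ one has φ₀(x,y,z)² + ‖χ(x,y,z)‖² = |x∧y∧z|² (Harvey–Lawson's identity for the associative calibration). -/
/-!
STATEMENT 0: Harvey–Lawson's identity for the associative calibration on ℝ⁷:
for all x, y, z ∈ ℝ⁷, φ₀(x,y,z)² + ‖χ(x,y,z)‖² = |x∧y∧z|²,
where ⟨χ(x,y,z), w⟩ = ψ₀(x,y,z,w) and |x∧y∧z|² is the Gram determinant.
-/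

noncomputable section
open scoped RealInnerProductSpace

abbrev E7 := EuclideanSpace ℝ (Fin 7)

/-- `dxⁱ ∧ dxʲ ∧ dxᵏ` evaluated on `(x, y, z)` (indices 0-based). -/
def d3 (i j k : Fin 7) (x y z : E7) : ℝ :=
  Matrix.det !![x i, x j, x k; y i, y j, y k; z i, z j, z k]

/-- `dxⁱ ∧ dxʲ ∧ dxᵏ ∧ dxˡ` evaluated on `(x, y, z, w)` (indices 0-based). -/
def d4 (i j k l : Fin 7) (x y z w : E7) : ℝ :=
  Matrix.det !![x i, x j, x k, x l; y i, y j, y k, y l;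
                z i, z j, z k, z l; w i, w j, w k, w l]

/-- The associative 3-form φ₀ = dx¹²³ + dx¹⁴⁵ − dx¹⁶⁷ + dx²⁴⁶ + dx²⁵⁷ + dx³⁴⁷ − dx³⁵⁶
(1-based indices; here 0-based). -/
def phi (x y z : E7) : ℝ :=
  d3 0 1 2 x y z + d3 0 3 4 x y z - d3 0 5 6 x y z + d3 1 3 5 x y z
    + d3 1 4 6 x y z + d3 2 3 6 x y z - d3 2 4 5 x y z

/-- The coassociative 4-form
ψ₀ = dx⁴⁵⁶⁷ + dx²³⁶⁷ − dx²³⁴⁵ + dx¹³⁵⁷ + dx¹³⁴⁶ + dx¹²⁵⁶ − dx¹²⁴⁷ (1-based; here 0-based). -/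
def psi (x y z w : E7) : ℝ :=
  d4 3 4 5 6 x y z w + d4 1 2 5 6 x y z w - d4 1 2 3 4 x y z w + d4 0 2 4 6 x y z w
    + d4 0 2 3 5 x y z w + d4 0 1 4 5 x y z w - d4 0 1 3 6 x y z w

/-- The Gram determinant |x∧y∧z|² = det(⟨vᵢ,vⱼ⟩). -/
def gram3 (x y z : E7) : ℝ :=
  Matrix.det !![⟪x, x⟫, ⟪x, y⟫, ⟪x, z⟫;
                ⟪y, x⟫, ⟪y, y⟫, ⟪y, z⟫;
                ⟪z, x⟫, ⟪z, y⟫, ⟪z, z⟫]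

/-- The squared norm of the vector representing `psi x y z` is the sum of the squares of its
values on the standard basis. -/
theorem norm_sq_of_rep (v x y z : E7) (h : ∀ w : E7, ⟪v, w⟫ = psi x y z w) :
    ‖v‖ ^ 2 = ∑ i : Fin 7, psi x y z (EuclideanSpace.single i 1) ^ 2 := by
  rw [EuclideanSpace.norm_sq_eq]
  refine Finset.sum_congr rfl fun i _ => ?_
  rw [← h, EuclideanSpace.inner_single_right]
  simp

theorem d3_eq (i j k : Fin 7) (x y z : E7) :
    d3 i j k x y z = x i * (y j * z k - y k * z j) - x j * (y i * z k - y k * z i)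
      + x k * (y i * z j - y j * z i) := by
  simp [d3, Matrix.det_fin_three]; ring

theorem d4_eq (i j k l : Fin 7) (x y z w : E7) :
    d4 i j k l x y z w = w l * d3 i j k x y z - w k * d3 i j l x y z
      + w j * d3 i k l x y z - w i * d3 j k l x y z := by
  simp [d4, d3_eq, Matrix.det_succ_row_zero, Fin.sum_univ_succ, Fin.succAbove]; ring

set_option maxHeartbeats 4000000 in
/-- Harvey–Lawson's identity for the associative calibration. -/
theorem associative_harvey_lawson
    (chi : E7 → E7 → E7 → E7)
    (hchi : ∀ x y z w : E7, ⟪chi x y z, w⟫ = psi x y z w) :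
    ∀ x y z : E7, phi x y z ^ 2 + ‖chi x y z‖ ^ 2 = gram3 x y z := by
  intro x y z
  rw [norm_sq_of_rep _ x y z (hchi x y z)]
  simp only [Fin.sum_univ_seven, psi, d4_eq, phi, gram3, Matrix.det_fin_three,
    PiLp.inner_apply, Fin.isValue]
  simp [Fin.sum_univ_seven, d3_eq]
  ring
end
end

section
/- The associative 3-form φ₀ is a calibration on ℝ⁷: for all vectors x, y, z in ℝ⁷, φ₀(x,y,z)² ≤ |x∧y∧z|²; in particular |φ₀(x,y,z)| ≤ 1 whenever x, y, z are orthonormal. -/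
noncomputable section
open scoped RealInnerProductSpace

/-- The 2 by 2 minor of `x, y` in the columns `i, j`. -/
def mnr (x y : E7) (i j : Fin 7) : ℝ := x i * y j - x j * y i

/-- The cross product on ℝ⁷ determined by `phi x y z = ⟪x × y, z⟫`. -/
def crs (x y : E7) : E7 :=
  !₂[mnr x y 1 2 + mnr x y 3 4 - mnr x y 5 6,
     mnr x y 2 0 + mnr x y 3 5 + mnr x y 4 6,
     mnr x y 0 1 + mnr x y 3 6 - mnr x y 4 5,
     mnr x y 4 0 + mnr x y 5 1 + mnr x y 6 2,
     mnr x y 0 3 + mnr x y 6 1 - mnr x y 5 2,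
     -mnr x y 6 0 + mnr x y 1 3 - mnr x y 2 4,
     -mnr x y 0 5 + mnr x y 1 4 + mnr x y 2 3]

lemma inner7 (x y : E7) : ⟪x, y⟫ = x 0 * y 0 + x 1 * y 1 + x 2 * y 2 + x 3 * y 3
    + x 4 * y 4 + x 5 * y 5 + x 6 * y 6 := by
  simp [PiLp.inner_apply, Fin.sum_univ_seven, mul_comm]

lemma phi_eq (x y z : E7) : phi x y z = ⟪crs x y, z⟫ := by
  rw [inner7]
  simp [phi, d3, crs, mnr, Matrix.det_fin_three]
  ring

lemma crs_left (x y : E7) : ⟪crs x y, x⟫ = 0 := by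
  rw [inner7]
  simp [crs, mnr]
  ring

lemma crs_right (x y : E7) : ⟪crs x y, y⟫ = 0 := by
  rw [inner7]
  simp [crs, mnr]
  ring

lemma crs_norm (x y : E7) : ⟪crs x y, crs x y⟫ = ⟪x, x⟫ * ⟪y, y⟫ - ⟪x, y⟫ ^ 2 := by
  simp only [inner7]
  simp [crs, mnr]
  ring

lemma gram3_nonneg (x y z : E7) : 0 ≤ gram3 x y z := by
  have h := (Matrix.posSemidef_gram ℝ ![x, y, z]).det_nonneg
  have hM : !![⟪x, x⟫, ⟪x, y⟫, ⟪x, z⟫; ⟪y, x⟫, ⟪y, y⟫, ⟪y, z⟫; ⟪z, x⟫, ⟪z, y⟫, ⟪z, z⟫]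
      = Matrix.gram ℝ ![x, y, z] := by
    ext i j
    fin_cases i <;> fin_cases j <;> simp [Matrix.gram]
  unfold gram3
  rw [hM]
  exact h

lemma phi_sq_le (x y z : E7) : phi x y z ^ 2 ≤ gram3 x y z := by
  by_cases hc : crs x y = 0
  · rw [phi_eq, hc]
    simpa using gram3_nonneg x y z
  have hN : 0 < ⟪crs x y, crs x y⟫ := real_inner_self_pos.mpr hc
  have hn := crs_norm x y
  set N : ℝ := ⟪crs x y, crs x y⟫ with hNdef
  let a : ℝ := ⟪x, z⟫ * ⟪y, y⟫ - ⟪x, y⟫ * ⟪y, z⟫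
  let b : ℝ := ⟪y, z⟫ * ⟪x, x⟫ - ⟪x, y⟫ * ⟪x, z⟫
  have h1 : ⟪crs x y, N • z - a • x - b • y⟫ = N * phi x y z := by
    simp only [inner_sub_right, inner_smul_right, crs_left, crs_right, phi_eq]
    ring
  have h2 : ⟪N • z - a • x - b • y, N • z - a • x - b • y⟫ = N * gram3 x y z := by
    simp only [inner_sub_right, inner_sub_left, real_inner_smul_left, real_inner_smul_right,
      gram3, Matrix.det_fin_three]
    simp only [real_inner_comm x y, real_inner_comm x z, real_inner_comm y z, hn, a, b,
      Matrix.of_apply, Matrix.cons_val]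
    ring
  have h3 := real_inner_mul_inner_self_le (crs x y) (N • z - a • x - b • y)
  rw [h1, h2, ← hNdef] at h3
  have h4 : 0 < N * N := mul_pos hN hN
  refine le_of_mul_le_mul_left ?_ h4
  linarith

/-- the associative 3-form is a calibration on ℝ⁷:
`φ₀(x,y,z)² ≤ |x∧y∧z|²` for all `x,y,z`, and `|φ₀(x,y,z)| ≤ 1` on orthonormal triples. -/
theorem associative_is_calibration :
    (∀ x y z : E7, phi x y z ^ 2 ≤ gram3 x y z) ∧
    (∀ x y z : E7, Orthonormal ℝ ![x, y, z] → |phi x y z| ≤ 1) := by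
  refine ⟨phi_sq_le, fun x y z h => ?_⟩
  have hg : gram3 x y z = 1 := by
    rw [orthonormal_iff_ite] at h
    have e (i j : Fin 3) := h i j
    have h00 := e 0 0
    have h01 := e 0 1
    have h02 := e 0 2
    have h10 := e 1 0
    have h11 := e 1 1
    have h12 := e 1 2
    have h20 := e 2 0
    have h21 := e 2 1
    have h22 := e 2 2
    simp only [Matrix.cons_val] at h00 h01 h02 h10 h11 h12 h20 h21 h22
    simp only [gram3, h00, h01, h02, h10, h11, h12, h20, h21, h22]
    simp [Matrix.det_fin_three]
  have := phi_sq_le x y z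
  rw [hg] at this
  exact (sq_le_one_iff_abs_le_one _).mp this
end
end

section
/- If x, y, z are orthonormal vectors in ℝ⁷, then χ(x,y,z) = 0 if and only if φ₀(x,y,z) = 1 or φ₀(x,y,z) = −1 (vanishing of χ characterizes associative 3-planes). -/
noncomputable section
open scoped RealInnerProductSpace

/-- The polynomial identity `φ² + |χ|² = det Gram`, evaluated on the standard basis. -/
theorem key_identity (x y z : E7) :
    phi x y z ^ 2 + ∑ k : Fin 7, psi x y z (EuclideanSpace.single k 1) ^ 2 =
      Matrix.det !![∑ i, x i * x i, ∑ i, x i * y i, ∑ i, x i * z i;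
        ∑ i, x i * y i, ∑ i, y i * y i, ∑ i, y i * z i;
        ∑ i, x i * z i, ∑ i, y i * z i, ∑ i, z i * z i] := by
  have d4e : ∀ (i j k l : Fin 7) (w : E7), d4 i j k l x y z w =
      - w i * d3 j k l x y z + w j * d3 i k l x y z - w k * d3 i j l x y z
        + w l * d3 i j k x y z := by
    intro i j k l w
    simp only [d4, d3, Matrix.det_succ_row_zero, Matrix.det_fin_three, Fin.sum_univ_succ]
    simp [Fin.succAbove, Matrix.submatrix]
    ring
  simp only [psi, d4e, phi, Fin.sum_univ_seven]
  simp [PiLp.single_apply, d3, Matrix.det_fin_three]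
  ring

/-- for orthonormal `x, y, z` in ℝ⁷, the vector `χ(x,y,z)` (defined by
`⟨χ(x,y,z), w⟩ = ψ₀(x,y,z,w)` for all `w`) vanishes iff `φ₀(x,y,z) = ±1`. -/
theorem chi_eq_zero_iff_associative
    (chi : E7 → E7 → E7 → E7)
    (hchi : ∀ x y z w : E7, ⟪chi x y z, w⟫ = psi x y z w) :
    ∀ x y z : E7, Orthonormal ℝ ![x, y, z] →
      (chi x y z = 0 ↔ phi x y z = 1 ∨ phi x y z = -1) := by
  intro x y z h
  have hx : ∑ i, x i * x i = 1 := by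
    have : ⟪x, x⟫ = 1 := inner_self_eq_one_of_norm_eq_one (𝕜 := ℝ) (h.1 0)
    simpa only [PiLp.inner_apply, RCLike.inner_apply, conj_trivial] using this
  have hy : ∑ i, y i * y i = 1 := by
    have : ⟪y, y⟫ = 1 := inner_self_eq_one_of_norm_eq_one (𝕜 := ℝ) (h.1 1)
    simpa only [PiLp.inner_apply, RCLike.inner_apply, conj_trivial] using this
  have hz : ∑ i, z i * z i = 1 := by
    have : ⟪z, z⟫ = 1 := inner_self_eq_one_of_norm_eq_one (𝕜 := ℝ) (h.1 2)
    simpa only [PiLp.inner_apply, RCLike.inner_apply, conj_trivial] using this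
  have hxy : ∑ i, x i * y i = 0 := by
    have : ⟪y, x⟫ = 0 := h.2 (show (1 : Fin 3) ≠ 0 by decide)
    simpa only [PiLp.inner_apply, RCLike.inner_apply, conj_trivial] using this
  have hxz : ∑ i, x i * z i = 0 := by
    have : ⟪z, x⟫ = 0 := h.2 (show (2 : Fin 3) ≠ 0 by decide)
    simpa only [PiLp.inner_apply, RCLike.inner_apply, conj_trivial] using this
  have hyz : ∑ i, y i * z i = 0 := by
    have : ⟪z, y⟫ = 0 := h.2 (show (2 : Fin 3) ≠ 1 by decide)
    simpa only [PiLp.inner_apply, RCLike.inner_apply, conj_trivial] using this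
  have key := key_identity x y z
  rw [hx, hy, hz, hxy, hxz, hyz] at key
  have hdet : Matrix.det !![(1 : ℝ), 0, 0; 0, 1, 0; 0, 0, 1] = 1 := by
    simp [Matrix.det_fin_three]
  rw [hdet] at key
  have hc : ∀ k, psi x y z (EuclideanSpace.single k 1) = chi x y z k := by
    intro k
    rw [← hchi]
    simp [EuclideanSpace.inner_single_right]
  simp only [hc] at key
  have e : phi x y z ^ 2 = 1 ↔ phi x y z = 1 ∨ phi x y z = -1 := by simp
  rw [← e]
  constructor
  · intro h0
    simpa [h0] using key
  · intro h1
    have hs : ∑ k, chi x y z k ^ 2 = 0 := by linarith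
    rw [Finset.sum_eq_zero_iff_of_nonneg (fun _ _ => sq_nonneg _)] at hs
    ext k
    simpa using hs k (Finset.mem_univ k)
end
end

section
/- If x, y, z, w are orthonormal vectors in ℝ⁷, then τ(x,y,z,w) = 0 if and only if ψ₀(x,y,z,w) = 1 or ψ₀(x,y,z,w) = −1 (vanishing of τ characterizes coassociative 4-planes). -/
noncomputable section
open scoped RealInnerProductSpace

/-- The vector-valued 4-form
`τ(x,y,z,w) = −(φ₀(y,z,w)x + φ₀(z,x,w)y + φ₀(x,y,w)z + φ₀(y,x,z)w)`. -/
def tau (x y z w : E7) : E7 :=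
  -(phi y z w • x + phi z x w • y + phi x y w • z + phi y x z • w)

/-- The cross product attached to `phi`. -/
def cr (x y : E7) : E7 := !₂[
  (x 1*y 2-x 2*y 1) + (x 3*y 4-x 4*y 3) - (x 5*y 6-x 6*y 5),
  (x 2*y 0-x 0*y 2) + (x 3*y 5-x 5*y 3) + (x 4*y 6-x 6*y 4),
  (x 0*y 1-x 1*y 0) + (x 3*y 6-x 6*y 3) - (x 4*y 5-x 5*y 4),
  (x 4*y 0-x 0*y 4) + (x 5*y 1-x 1*y 5) + (x 6*y 2-x 2*y 6),
  (x 0*y 3-x 3*y 0) + (x 6*y 1-x 1*y 6) - (x 5*y 2-x 2*y 5),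
  -(x 6*y 0-x 0*y 6) + (x 1*y 3-x 3*y 1) - (x 2*y 4-x 4*y 2),
  -(x 0*y 5-x 5*y 0) + (x 1*y 4-x 4*y 1) + (x 2*y 3-x 3*y 2)]

theorem ip_eq (x y : E7) : inner ℝ x y =
    x 0*y 0+x 1*y 1+x 2*y 2+x 3*y 3+x 4*y 4+x 5*y 5+x 6*y 6 := by
  simp [PiLp.inner_apply, Fin.sum_univ_seven]; ring

theorem cr_phi (x y z : E7) : phi x y z = inner ℝ (cr x y) z := by
  simp [phi, d3, Matrix.det_fin_three, ip_eq, cr]; ring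

theorem cr_anti (x y : E7) : cr y x = - cr x y := by
  ext i; fin_cases i <;> simp [cr] <;> ring

theorem cr_cyc (x y z : E7) : inner ℝ (cr x y) z = inner ℝ x (cr y z) := by
  simp [ip_eq, cr]; ring

theorem cr_self (x : E7) : cr x x = 0 := by
  ext i; fin_cases i <;> simp [cr] <;> ring

theorem cr_sub_left (x y z : E7) : cr (x - y) z = cr x z - cr y z := by
  ext i; fin_cases i <;> simp [cr] <;> ring

theorem cr_smul_left (a : ℝ) (x z : E7) : cr (a • x) z = a • cr x z := by
  ext i; fin_cases i <;> simp [cr] <;> ring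

theorem cr_neg_right (x y : E7) : cr x (-y) = -cr x y := by
  ext i; fin_cases i <;> simp [cr] <;> ring

theorem cr_sub_right (x y z : E7) : cr z (x - y) = cr z x - cr z y := by
  ext i; fin_cases i <;> simp [cr] <;> ring

theorem cr_smul_right (a : ℝ) (x z : E7) : cr z (a • x) = a • cr z x := by
  ext i; fin_cases i <;> simp [cr] <;> ring

theorem cr_cr (x y : E7) :
    cr x (cr x y) = (inner ℝ x y : ℝ) • x - (inner ℝ x x : ℝ) • y := by
  rw [ip_eq, ip_eq]
  ext i; fin_cases i <;> simp [cr, ip_eq] <;> ring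

theorem cr_pol (x y z : E7) :
    cr x (cr y z) + cr y (cr x z) = (inner ℝ x z : ℝ) • y + (inner ℝ y z : ℝ) • x
      - (2 * inner ℝ x y : ℝ) • z := by
  ext i; fin_cases i <;> simp [cr, ip_eq] <;> ring

theorem cr_lag (x y : E7) : inner ℝ (cr x y) (cr x y) =
    (inner ℝ x x * inner ℝ y y - inner ℝ x y * inner ℝ x y : ℝ) := by
  simp only [ip_eq]
  simp [cr, ip_eq]; ring

theorem psi_cr (x y z w : E7) : psi x y z w = -inner ℝ (cr x y) (cr z w)
    + inner ℝ x z * inner ℝ y w - inner ℝ x w * inner ℝ y z := by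
  simp [psi, d4, Matrix.det_succ_row_zero, Fin.sum_univ_succ, cr, ip_eq, Fin.succAbove]; ring

/-- `x`-multiplication moves between slots of the 3-form. -/
theorem move13 (x s u v : E7) (hs : inner ℝ x s = (0:ℝ)) (hu : inner ℝ x u = (0:ℝ))
    (hv : inner ℝ x v = (0:ℝ)) :
    (inner ℝ (cr (cr x s) u) v : ℝ) = inner ℝ (cr s u) (cr x v) := by
  have h := congrArg (fun t => (inner ℝ t v : ℝ)) (cr_pol x u s)
  simp only [inner_add_left, inner_sub_left, inner_smul_left, hs, hu, hv] at h
  have h1 : cr u (cr x s) = - cr (cr x s) u := cr_anti _ _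
  have h2 : (inner ℝ (cr x (cr u s)) v : ℝ) = inner ℝ (cr s u) (cr x v) := by
    rw [real_inner_comm, ← cr_cyc, cr_anti x v, cr_anti s u, inner_neg_left, inner_neg_right,
      real_inner_comm, neg_neg]
  rw [h1, h2, inner_neg_left] at h
  simp at h
  linarith

theorem anti12 (s u v : E7) : (inner ℝ (cr u s) v : ℝ) = - inner ℝ (cr s u) v := by
  rw [cr_anti s u, inner_neg_left]

theorem perp_left (x y : E7) : (inner ℝ x (cr x y) : ℝ) = 0 := by
  rw [← cr_cyc, cr_self, inner_zero_left]

theorem perp_right (x y : E7) : (inner ℝ y (cr x y) : ℝ) = 0 := by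
  rw [real_inner_comm, cr_cyc, cr_self, inner_zero_right]

theorem tri_swap (x y s : E7) : (inner ℝ x (cr y s) : ℝ) = inner ℝ (cr x y) s := (cr_cyc _ _ _).symm

theorem tri_swap' (x y s : E7) : (inner ℝ y (cr x s) : ℝ) = - inner ℝ (cr x y) s := by
  rw [← cr_cyc, anti12]

theorem move12 (x s u v : E7) (hs : inner ℝ x s = (0:ℝ)) (hu : inner ℝ x u = (0:ℝ))
    (hv : inner ℝ x v = (0:ℝ)) :
    (inner ℝ (cr (cr x s) u) v : ℝ) = inner ℝ (cr s (cr x u)) v := by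
  rw [move13 x s u v hs hu hv, anti12 (cr x u) s v, move13 x u s v hu hs hv, anti12 u s]

theorem coassoc_aux (x y s u v : E7)
    (hxy : inner ℝ x y = (0:ℝ))
    (xs : inner ℝ x s = (0:ℝ)) (ys : inner ℝ y s = (0:ℝ)) (ps : inner ℝ (cr x y) s = (0:ℝ))
    (xu : inner ℝ x u = (0:ℝ)) (yu : inner ℝ y u = (0:ℝ)) (pu : inner ℝ (cr x y) u = (0:ℝ))
    (xv : inner ℝ x v = (0:ℝ)) (yv : inner ℝ y v = (0:ℝ)) (pv : inner ℝ (cr x y) v = (0:ℝ)) :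
    (inner ℝ (cr (cr x (cr y s)) u) v : ℝ) = 0 := by
  have e1 := move13 x (cr y s) u v (by rw [tri_swap, ps]) xu xv
  have e2 := move12 y s u (cr x v) ys yu (by rw [tri_swap', pv, neg_zero])
  have e3 := move13 x s (cr y u) v xs (by rw [tri_swap, pu]) xv
  have e4 := move12 y (cr x s) u v (by rw [tri_swap', ps, neg_zero]) yu yv
  have h := cr_pol x y s
  rw [hxy, xs, ys] at h
  simp at h
  have h' : cr y (cr x s) = - cr x (cr y s) := by
    rw [eq_neg_iff_add_eq_zero, add_comm]; exact h
  have e5 : (inner ℝ (cr (cr y (cr x s)) u) v : ℝ) = - inner ℝ (cr (cr x (cr y s)) u) v := by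
    rw [h', cr_anti u, cr_neg_right, neg_neg, anti12 (cr x (cr y s)) u]
  linarith

theorem coassoc (x y s u v : E7)
    (hxx : inner ℝ x x = (1:ℝ)) (hyy : inner ℝ y y = (1:ℝ)) (hxy : inner ℝ x y = (0:ℝ))
    (xs : inner ℝ x s = (0:ℝ)) (ys : inner ℝ y s = (0:ℝ)) (ps : inner ℝ (cr x y) s = (0:ℝ))
    (xu : inner ℝ x u = (0:ℝ)) (yu : inner ℝ y u = (0:ℝ)) (pu : inner ℝ (cr x y) u = (0:ℝ))
    (xv : inner ℝ x v = (0:ℝ)) (yv : inner ℝ y v = (0:ℝ)) (pv : inner ℝ (cr x y) v = (0:ℝ)) :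
    (inner ℝ (cr s u) v : ℝ) = 0 := by
  have yxs : inner ℝ y (cr x s) = (0:ℝ) := by rw [tri_swap', ps, neg_zero]
  have k1 : cr x (cr x s) = - s := by rw [cr_cr, xs, hxx]; simp
  have k2 : cr y (cr y (cr x s)) = - cr x s := by rw [cr_cr, yxs, hyy]; simp
  have k3 : cr x (cr y (cr y (cr x s))) = s := by rw [k2, cr_neg_right, k1, neg_neg]
  have h := coassoc_aux x y (cr y (cr x s)) u v hxy ?_ (perp_left _ _) ?_ xu yu pu xv yv pv
  · rwa [k3] at h
  · rw [← cr_cyc, tri_swap', cr_cr, hxy, hxx]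
    simp [inner_neg_left, ys]
  · have : cr (cr x y) y = - x := by
      rw [cr_anti y, cr_anti y x, cr_neg_right, cr_cr, hyy, real_inner_comm, hxy]; simp
    rw [← cr_cyc, this, inner_neg_left, perp_left, neg_zero]

/-- The coassociator equality on orthonormal quadruples. -/
theorem main_identity (x y z w : E7)
    (xx : inner ℝ x x = (1:ℝ)) (yy : inner ℝ y y = (1:ℝ)) (zz : inner ℝ z z = (1:ℝ))
    (ww : inner ℝ w w = (1:ℝ)) (xy : inner ℝ x y = (0:ℝ)) (xz : inner ℝ x z = (0:ℝ))
    (xw : inner ℝ x w = (0:ℝ)) (yz : inner ℝ y z = (0:ℝ)) (yw : inner ℝ y w = (0:ℝ))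
    (zw : inner ℝ z w = (0:ℝ)) :
    phi y z w ^ 2 + phi z x w ^ 2 + phi x y w ^ 2 + phi y x z ^ 2 + psi x y z w ^ 2 = 1 := by
  obtain ⟨p, hp⟩ : ∃ p, p = cr x y := ⟨_, rfl⟩
  obtain ⟨a, ha⟩ : ∃ a : ℝ, a = inner ℝ p z := ⟨_, rfl⟩
  obtain ⟨b, hb⟩ : ∃ b : ℝ, b = inner ℝ p w := ⟨_, rfl⟩
  have xp : inner ℝ x p = (0:ℝ) := by rw [hp, perp_left]
  have yp : inner ℝ y p = (0:ℝ) := by rw [hp, perp_right]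
  have px : inner ℝ p x = (0:ℝ) := by rw [real_inner_comm, xp]
  have py : inner ℝ p y = (0:ℝ) := by rw [real_inner_comm, yp]
  have yx : inner ℝ y x = (0:ℝ) := by rw [real_inner_comm, xy]
  have pp : inner ℝ p p = (1:ℝ) := by rw [hp, cr_lag, xx, yy, xy]; norm_num
  have zp : inner ℝ z p = a := by rw [real_inner_comm, ha]
  have xcp : cr x p = - y := by rw [hp, cr_cr, xy, xx]; simp
  have ycp : cr y p = x := by rw [hp, cr_anti y x, cr_neg_right, cr_cr, yx, yy]; simp
  obtain ⟨u, hu⟩ : ∃ u, u = z - a • p := ⟨_, rfl⟩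
  obtain ⟨v, hv⟩ : ∃ v, v = w - b • p := ⟨_, rfl⟩
  have xu : inner ℝ x u = (0:ℝ) := by rw [hu, inner_sub_right, inner_smul_right, xz, xp]; simp
  have yu : inner ℝ y u = (0:ℝ) := by rw [hu, inner_sub_right, inner_smul_right, yz, yp]; simp
  have pu : inner ℝ p u = (0:ℝ) := by rw [hu, inner_sub_right, inner_smul_right, ← ha, pp]; simp
  have xv : inner ℝ x v = (0:ℝ) := by rw [hv, inner_sub_right, inner_smul_right, xw, xp]; simp
  have yv : inner ℝ y v = (0:ℝ) := by rw [hv, inner_sub_right, inner_smul_right, yw, yp]; simp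
  have pv : inner ℝ p v = (0:ℝ) := by rw [hv, inner_sub_right, inner_smul_right, ← hb, pp]; simp
  have zu : z = u + a • p := by rw [hu]; simp
  have wv : w = v + b • p := by rw [hv]; simp
  have up : inner ℝ u p = (0:ℝ) := by rw [real_inner_comm, pu]
  have vp : inner ℝ v p = (0:ℝ) := by rw [real_inner_comm, pv]
  have uu : inner ℝ u u = 1 - a^2 := by
    rw [zu] at zz
    simp only [inner_add_left, inner_add_right, real_inner_smul_left, real_inner_smul_right, pu, up,
      pp] at zz
    linarith
  have vv : inner ℝ v v = 1 - b^2 := by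
    rw [wv] at ww
    simp only [inner_add_left, inner_add_right, real_inner_smul_left, real_inner_smul_right, pv, vp,
      pp] at ww
    linarith
  have uv : inner ℝ u v = - (a * b) := by
    rw [zu, wv] at zw
    simp only [inner_add_left, inner_add_right, real_inner_smul_left, real_inner_smul_right, pv, up,
      pp] at zw
    linarith
  -- the cross product of the projected vectors
  have hq : cr z w = cr u v + b • cr u p + a • cr p v := by
    rw [hu, hv]
    simp only [cr_sub_left, cr_sub_right, cr_smul_left, cr_smul_right, cr_self]
    module
  have xq : inner ℝ x (cr z w) = (inner ℝ x (cr u v) : ℝ) := by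
    rw [hq]
    simp only [inner_add_right, real_inner_smul_right, tri_swap' u x p, tri_swap x p v,
      xcp, inner_neg_left, yv, cr_cyc u x p, inner_neg_right]
    rw [real_inner_comm y u, yu]; simp
  have yq : inner ℝ y (cr z w) = (inner ℝ y (cr u v) : ℝ) := by
    rw [hq]
    simp only [inner_add_right, real_inner_smul_right, tri_swap' u y p, tri_swap y p v,
      ycp, xv, cr_cyc u y p]
    rw [real_inner_comm x u, xu]; simp
  have pq : inner ℝ p (cr z w) = (inner ℝ p (cr u v) : ℝ) := by
    rw [hq]
    simp only [inner_add_right, real_inner_smul_right, perp_left, perp_right]; simp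
  obtain ⟨s, hs⟩ : ∃ s, s = cr u v - (inner ℝ x (cr u v) : ℝ) • x - (inner ℝ y (cr u v) : ℝ) • y
    - (inner ℝ p (cr u v) : ℝ) • p := ⟨_, rfl⟩
  have xs : inner ℝ x s = (0:ℝ) := by
    rw [hs]; simp only [inner_sub_right, real_inner_smul_right, xx, xy, xp]; ring
  have ys : inner ℝ y s = (0:ℝ) := by
    rw [hs]; simp only [inner_sub_right, real_inner_smul_right, yx, yy, yp]; ring
  have ps : inner ℝ p s = (0:ℝ) := by
    rw [hs]; simp only [inner_sub_right, real_inner_smul_right, px, py, pp]; ring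
  have key := coassoc x y s u v xx yy xy xs ys (hp ▸ ps) xu yu (hp ▸ pu) xv yv (hp ▸ pv)
  have rs : inner ℝ s (cr u v) = (0:ℝ) := by rw [← cr_cyc, key]
  rw [hs] at rs
  simp only [inner_sub_left, real_inner_smul_left, cr_lag, uu, vv, uv] at rs
  have f1 : phi y z w = inner ℝ y (cr u v) := by rw [cr_phi, cr_cyc, yq]
  have f2 : phi z x w = - inner ℝ x (cr u v) := by rw [cr_phi, anti12 x z, cr_cyc, xq]
  have f3 : phi x y w = b := by rw [cr_phi, hb, hp]
  have f4 : phi y x z = - a := by rw [cr_phi, anti12 x y, ha, hp]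
  have f5 : psi x y z w = - inner ℝ p (cr u v) := by rw [psi_cr, ← hp, pq, xz, xw]; ring
  rw [f1, f2, f3, f4, f5]
  linarith

/-- for orthonormal `x, y, z, w` in ℝ⁷, `τ(x,y,z,w) = 0` iff
`ψ₀(x,y,z,w) = ±1` (vanishing of τ characterizes coassociative 4-planes). -/
theorem tau_eq_zero_iff_coassociative :
    ∀ x y z w : E7, Orthonormal ℝ ![x, y, z, w] →
      (tau x y z w = 0 ↔ psi x y z w = 1 ∨ psi x y z w = -1) := by
  intro x y z w h
  have hi := orthonormal_iff_ite.mp h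
  have xx : inner ℝ x x = (1:ℝ) := by simpa using hi 0 0
  have yy : inner ℝ y y = (1:ℝ) := by simpa using hi 1 1
  have zz : inner ℝ z z = (1:ℝ) := by simpa using hi 2 2
  have ww : inner ℝ w w = (1:ℝ) := by simpa using hi 3 3
  have xy : inner ℝ x y = (0:ℝ) := by simpa using hi 0 1
  have xz : inner ℝ x z = (0:ℝ) := by simpa using hi 0 2
  have xw : inner ℝ x w = (0:ℝ) := by simpa using hi 0 3
  have yz : inner ℝ y z = (0:ℝ) := by simpa using hi 1 2
  have yw : inner ℝ y w = (0:ℝ) := by simpa using hi 1 3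
  have zw : inner ℝ z w = (0:ℝ) := by simpa using hi 2 3
  have m := main_identity x y z w xx yy zz ww xy xz xw yz yw zw
  have n : inner ℝ (tau x y z w) (tau x y z w)
      = phi y z w ^ 2 + phi z x w ^ 2 + phi x y w ^ 2 + phi y x z ^ 2 := by
    have yx : inner ℝ y x = (0:ℝ) := by rw [real_inner_comm, xy]
    have zx : inner ℝ z x = (0:ℝ) := by rw [real_inner_comm, xz]
    have wx : inner ℝ w x = (0:ℝ) := by rw [real_inner_comm, xw]
    have zy : inner ℝ z y = (0:ℝ) := by rw [real_inner_comm, yz]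
    have wy : inner ℝ w y = (0:ℝ) := by rw [real_inner_comm, yw]
    have wz : inner ℝ w z = (0:ℝ) := by rw [real_inner_comm, zw]
    simp only [tau, inner_neg_left, inner_neg_right, inner_add_left, inner_add_right,
      real_inner_smul_left, real_inner_smul_right, yx, zx, wx, zy, wy, wz,
      xx, yy, zz, ww, xy, xz, xw, yz, yw, zw]
    ring
  have q : psi x y z w ^ 2 = 1 ↔ psi x y z w = 1 ∨ psi x y z w = -1 := by
    simp
  rw [← q, ← inner_self_eq_zero (𝕜 := ℝ), n]
  constructor <;> intro h <;> linarith
end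
end

section
/- Let E be a finite-dimensional real inner product space and let φ be an alternating k-form on E of comass at most one, i.e. φ(u₁,…,uₖ) ≤ 1 for every orthonormal k-tuple (u₁,…,uₖ). If (e₁,…,eₖ) is an orthonormal k-tuple with φ(e₁,…,eₖ) = 1 and v ∈ E is orthogonal to each eᵢ, then φ(v, e₂, …, eₖ) = 0 (the interior product of a normal vector with the calibration vanishes on a calibrated plane). -/
/-!
STATEMENT 10: if an alternating k-form φ on a finite-dimensional real inner product
space has comass at most one, (e₁,…,eₖ) is an orthonormal k-tuple with φ(e₁,…,eₖ) = 1,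
and v is orthogonal to each eᵢ, then φ(v, e₂, …, eₖ) = 0.
-/

open scoped RealInnerProductSpace

theorem interior_product_of_normal_vanishes
    {E : Type*} [NormedAddCommGroup E] [InnerProductSpace ℝ E] [FiniteDimensional ℝ E]
    {k : ℕ} (hk : 0 < k)
    (φ : AlternatingMap ℝ E ℝ (Fin k))
    (hcomass : ∀ u : Fin k → E, Orthonormal ℝ u → φ u ≤ 1)
    (e : Fin k → E) (he : Orthonormal ℝ e) (heφ : φ e = 1)
    (v : E) (hv : ∀ i, ⟪v, e i⟫ = 0) :
    φ (Function.update e ⟨0, hk⟩ v) = 0 := by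
  set i0 : Fin k := ⟨0, hk⟩ with hi0
  set a : ℝ := φ (Function.update e i0 v) with ha
  have hon := orthonormal_iff_ite.mp he
  have hev : ∀ i, ⟪e i, v⟫ = 0 := fun i => by rw [real_inner_comm]; exact hv i
  have key : ∀ t : ℝ, 1 + t * a ≤ Real.sqrt (1 + t ^ 2 * ⟪v, v⟫) := by
    intro t
    have hvv : 0 ≤ ⟪v, v⟫ := real_inner_self_nonneg
    have hpos : 0 < 1 + t ^ 2 * ⟪v, v⟫ := by positivity
    set r := Real.sqrt (1 + t ^ 2 * ⟪v, v⟫) with hr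
    have hrpos : 0 < r := Real.sqrt_pos.mpr hpos
    have hr2 : r * r = 1 + t ^ 2 * ⟪v, v⟫ := Real.mul_self_sqrt hpos.le
    have hort : Orthonormal ℝ (Function.update e i0 (r⁻¹ • (e i0 + t • v))) := by
      rw [orthonormal_iff_ite]
      intro i j
      have h00 : ⟪e i0, e i0⟫ = 1 := by simpa using hon i0 i0
      by_cases hi : i = i0 <;> by_cases hj : j = i0
      · subst hi; subst hj
        simp only [Function.update_self, inner_smul_left, inner_smul_right, inner_add_left,
          inner_add_right, hv, hev, h00, if_true, RCLike.conj_to_real]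
        field_simp
        nlinarith
      · subst hi
        have := hon i0 j
        rw [if_neg (Ne.symm hj)] at this
        simp [Function.update_of_ne hj, inner_smul_left, inner_add_left, hv, this, Ne.symm hj]
      · subst hj
        have := hon i i0
        rw [if_neg hi] at this
        simp [Function.update_of_ne hi, inner_smul_right, inner_add_right, hev, this, hi]
      · rw [Function.update_of_ne hi, Function.update_of_ne hj]
        exact hon i j
    have h := hcomass _ hort
    rw [AlternatingMap.map_update_smul, AlternatingMap.map_update_add,
      AlternatingMap.map_update_smul, Function.update_eq_self, heφ, ← ha] at h
    simp only [smul_eq_mul] at h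
    rwa [inv_mul_le_iff₀ hrpos, mul_one] at h
  by_contra hne
  have hvv : 0 ≤ ⟪v, v⟫ := real_inner_self_nonneg
  generalize ⟪v, v⟫ = n at key hvv
  have ha2 : 0 < a ^ 2 := by positivity
  have hc : 0 < (n + 1)⁻¹ := by positivity
  have hcn : (n + 1)⁻¹ * n ≤ 1 := by
    rw [inv_mul_le_iff₀ (by positivity)]; linarith
  have h := key ((n + 1)⁻¹ * a)
  generalize (n + 1)⁻¹ = c at h hc hcn
  have h1 : 0 ≤ 1 + c * a * a := by nlinarith [mul_pos hc ha2]
  have h2 := (Real.le_sqrt' (by nlinarith [mul_pos hc ha2])).mp h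
  have h3 : 0 < c * a ^ 2 := mul_pos hc ha2
  have h4 : c * a ^ 2 * (c * n) ≤ c * a ^ 2 := by nlinarith
  nlinarith [sq_nonneg (c * a * a)]
end

section
/- Every linear map A : ℝ⁷ → ℝ⁷ satisfying φ₀(Ax, Ay, Az) = φ₀(x,y,z) for all x, y, z ∈ ℝ⁷ is a special orthogonal transformation: ⟨Ax, Ay⟩ = ⟨x, y⟩ for all x, y and det A = 1 (the stabilizer G₂ of φ₀ is contained in SO(7)). -/
noncomputable section
open scoped RealInnerProductSpace

/-- Structure constants of `phi`. -/
def eps (i j k : Fin 7) : ℤ :=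
  match i.val, j.val, k.val with
  | 0, 1, 2 => 1 | 1, 2, 0 => 1 | 2, 0, 1 => 1 | 0, 2, 1 => -1 | 2, 1, 0 => -1 | 1, 0, 2 => -1
  | 0, 3, 4 => 1 | 3, 4, 0 => 1 | 4, 0, 3 => 1 | 0, 4, 3 => -1 | 4, 3, 0 => -1 | 3, 0, 4 => -1
  | 0, 5, 6 => -1 | 5, 6, 0 => -1 | 6, 0, 5 => -1 | 0, 6, 5 => 1 | 6, 5, 0 => 1 | 5, 0, 6 => 1
  | 1, 3, 5 => 1 | 3, 5, 1 => 1 | 5, 1, 3 => 1 | 1, 5, 3 => -1 | 5, 3, 1 => -1 | 3, 1, 5 => -1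
  | 1, 4, 6 => 1 | 4, 6, 1 => 1 | 6, 1, 4 => 1 | 1, 6, 4 => -1 | 6, 4, 1 => -1 | 4, 1, 6 => -1
  | 2, 3, 6 => 1 | 3, 6, 2 => 1 | 6, 2, 3 => 1 | 2, 6, 3 => -1 | 6, 3, 2 => -1 | 3, 2, 6 => -1
  | 2, 4, 5 => -1 | 4, 5, 2 => -1 | 5, 2, 4 => -1 | 2, 5, 4 => 1 | 5, 4, 2 => 1 | 4, 2, 5 => 1
  | _, _, _ => 0

/-- The sign of `b - a`. -/
def cmpSign (a b : Fin 7) : ℤ :=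
  bif Nat.blt a.val b.val then 1 else bif Nat.blt b.val a.val then -1 else 0

/-- Lazy multiplication. -/
def lmul (x y : ℤ) : ℤ :=
  match x with
  | Int.ofNat 0 => 0
  | x => x * y

/-- Sum over `Fin 7`, spelled out. -/
def sum7 (f : Fin 7 → ℤ) : ℤ := f 0 + f 1 + f 2 + f 3 + f 4 + f 5 + f 6

theorem lmul_eq (x y : ℤ) : lmul x y = x * y := by
  unfold lmul
  split
  · simp
  · rfl

theorem sum7_eq (f : Fin 7 → ℤ) : sum7 f = ∑ i, f i := by
  simp [sum7, Fin.sum_univ_seven]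

/-- The contraction, arranged for evaluation. -/
def contr (i j : Fin 7) : ℤ :=
  sum7 fun a => sum7 fun b => lmul (eps i a b) <| lmul (cmpSign a b) <|
  sum7 fun c => lmul (cmpSign a c) <| lmul (cmpSign b c) <|
  sum7 fun d => lmul (eps j c d) <| lmul (cmpSign a d) <| lmul (cmpSign b d) <|
    lmul (cmpSign c d) <|
  sum7 fun e => lmul (cmpSign a e) <| lmul (cmpSign b e) <| lmul (cmpSign c e) <|
    lmul (cmpSign d e) <|
  sum7 fun f => lmul (cmpSign a f) <| lmul (cmpSign b f) <| lmul (cmpSign c f) <|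
    lmul (cmpSign d f) <| lmul (cmpSign e f) <|
  sum7 fun g => lmul (eps e f g) <| lmul (cmpSign a g) <| lmul (cmpSign b g) <|
    lmul (cmpSign c g) <| lmul (cmpSign d g) <| lmul (cmpSign e g) (cmpSign f g)

theorem contr_eq : ∀ i j : Fin 7, contr i j = if i = j then -144 else 0 := by
  decide +kernel

set_option maxHeartbeats 4000000 in
theorem phi_eq_s15 (x y z : E7) :
    phi x y z = ∑ i, ∑ j, ∑ k, (eps i j k : ℝ) * (x i * y j * z k) := by
  simp only [phi, d3, Matrix.det_fin_three, Fin.sum_univ_seven]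
  simp [eps]
  ring

/-- The Levi-Civita symbol. -/
def lc (t : Fin 7 → Fin 7) : ℤ := ∏ i, ∏ j ∈ Finset.Ioi i, cmpSign (t i) (t j)

theorem cmpSign_self (a : Fin 7) : cmpSign a a = 0 := by
  revert a; decide

theorem cmpSign_of_ne : ∀ a b : Fin 7, a ≠ b → cmpSign a b = if a < b then 1 else -1 := by
  decide

theorem lc_perm (σ : Equiv.Perm (Fin 7)) : lc σ = (Equiv.Perm.sign σ : ℤ) := by
  rw [Equiv.Perm.sign_eq_prod_prod_Ioi]
  simp only [lc, Units.coe_prod]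
  refine Finset.prod_congr rfl fun i _ => Finset.prod_congr rfl fun j hj => ?_
  have hij : i ≠ j := (Finset.mem_Ioi.1 hj).ne
  rw [cmpSign_of_ne _ _ (fun h => hij (σ.injective h))]
  split <;> simp

theorem lc_eq_zero (t : Fin 7 → Fin 7) {i j : Fin 7} (hij : i < j) (h : t i = t j) :
    lc t = 0 := by
  refine Finset.prod_eq_zero (Finset.mem_univ i) ?_
  refine Finset.prod_eq_zero (Finset.mem_Ioi.2 hij) ?_
  rw [h, cmpSign_self]

theorem det_rows (W : Matrix (Fin 7) (Fin 7) ℝ) (s : Fin 7 → Fin 7) :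
    (W.submatrix s id).det = (lc s : ℝ) * W.det := by
  by_cases hs : Function.Injective s
  · have hb : Function.Bijective s := Finite.injective_iff_bijective.1 hs
    have h : s = ⇑(Equiv.ofBijective s hb) := rfl
    rw [h, Matrix.det_permute, lc_perm]
  · simp only [Function.Injective, not_forall] at hs
    obtain ⟨i, j, hst, hne⟩ := hs
    have h1 : (W.submatrix s id).det = 0 := by
      refine Matrix.det_zero_of_row_eq hne ?_
      funext k
      simp [hst]
    have h2 : lc s = 0 := by
      rcases lt_or_gt_of_ne hne with h | h
      · exact lc_eq_zero s h hst
      · exact lc_eq_zero s h hst.symm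
    rw [h1, h2]; simp

theorem alt_sum (W : Matrix (Fin 7) (Fin 7) ℝ) (c : (Fin 7 → Fin 7) → ℝ) :
    ∑ σ : Equiv.Perm (Fin 7), ((Equiv.Perm.sign σ : ℤ) : ℝ) *
      ∑ s : Fin 7 → Fin 7, c s * ∏ k, W (s k) (σ k)
      = (∑ s : Fin 7 → Fin 7, c s * (lc s : ℝ)) * W.det := by
  simp only [Finset.mul_sum, Finset.sum_mul]
  rw [Finset.sum_comm]
  refine Finset.sum_congr rfl fun s _ => ?_
  rw [mul_assoc, ← det_rows, ← Matrix.det_transpose, Matrix.det_apply', Finset.mul_sum]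
  refine Finset.sum_congr rfl fun σ _ => ?_
  simp only [Matrix.transpose_apply, Matrix.submatrix_apply, id]
  ring

theorem sum_cons {n : ℕ} (f : (Fin (n + 1) → Fin 7) → ℝ) :
    ∑ s, f s = ∑ a : Fin 7, ∑ s : Fin n → Fin 7, f (Matrix.vecCons a s) := by
  rw [← Fintype.sum_prod_type']
  exact (Equiv.sum_comp (Fin.consEquiv fun _ => Fin 7) f).symm

theorem sum_fun7 (f : (Fin 7 → Fin 7) → ℝ) :
    ∑ s, f s = ∑ a, ∑ b, ∑ c, ∑ d, ∑ e, ∑ g, ∑ h, f ![a, b, c, d, e, g, h] := by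
  simp only [sum_cons, Fintype.sum_unique]
  simp only [Matrix.empty_eq]

/-- The coefficients of `ι_u φ ⊗ ι_v φ ⊗ φ`. -/
def coef (u v : E7) (s : Fin 7 → Fin 7) : ℝ :=
  (∑ i, (eps i (s 0) (s 1) : ℝ) * u i) * (∑ i, (eps i (s 2) (s 3) : ℝ) * v i) *
    (eps (s 4) (s 5) (s 6) : ℝ)

theorem phi_eq' (u y z : E7) :
    phi u y z = ∑ j, ∑ k, (∑ i, (eps i j k : ℝ) * u i) * (y j * z k) := by
  rw [phi_eq_s15, Finset.sum_comm]
  refine Finset.sum_congr rfl fun j _ => ?_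
  rw [Finset.sum_comm]
  refine Finset.sum_congr rfl fun k _ => ?_
  rw [Finset.sum_mul]
  exact Finset.sum_congr rfl fun i _ => by ring

theorem prod_phi (u v : E7) (w : Fin 7 → E7) :
    phi u (w 0) (w 1) * phi v (w 2) (w 3) * phi (w 4) (w 5) (w 6)
      = ∑ s : Fin 7 → Fin 7, coef u v s * ∏ k, w k (s k) := by
  rw [sum_fun7, phi_eq' u, phi_eq' v, phi_eq_s15 (w 4), mul_assoc]
  simp only [coef]
  generalize hp : (fun a b => ∑ i, (eps i a b : ℝ) * u i) = p
  generalize hq : (fun a b => ∑ i, (eps i a b : ℝ) * v i) = q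
  have hp' : ∀ a b, ∑ i, (eps i a b : ℝ) * u i = p a b := fun a b => by rw [← hp]
  have hq' : ∀ a b, ∑ i, (eps i a b : ℝ) * v i = q a b := fun a b => by rw [← hq]
  simp only [hp', hq']
  rw [Finset.sum_mul]
  refine Finset.sum_congr rfl fun a _ => ?_
  rw [Finset.sum_mul]
  refine Finset.sum_congr rfl fun b _ => ?_
  rw [Finset.sum_mul, Finset.mul_sum]
  refine Finset.sum_congr rfl fun c _ => ?_
  rw [Finset.sum_mul, Finset.mul_sum]
  refine Finset.sum_congr rfl fun d _ => ?_
  rw [Finset.mul_sum, Finset.mul_sum]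
  refine Finset.sum_congr rfl fun e _ => ?_
  rw [Finset.mul_sum, Finset.mul_sum]
  refine Finset.sum_congr rfl fun f _ => ?_
  rw [Finset.mul_sum, Finset.mul_sum]
  refine Finset.sum_congr rfl fun g _ => ?_
  rw [Fin.prod_univ_seven]
  change _ = (p a b * q c d * (eps e f g : ℝ)) *
    (w 0 a * w 1 b * w 2 c * w 3 d * w 4 e * w 5 f * w 6 g)
  ring

theorem lc_vec (a b c d e f g : Fin 7) : lc ![a, b, c, d, e, f, g] =
    cmpSign a b * cmpSign a c * cmpSign a d * cmpSign a e * cmpSign a f * cmpSign a g *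
    (cmpSign b c * cmpSign b d * cmpSign b e * cmpSign b f * cmpSign b g) *
    (cmpSign c d * cmpSign c e * cmpSign c f * cmpSign c g) *
    (cmpSign d e * cmpSign d f * cmpSign d g) * (cmpSign e f * cmpSign e g) * cmpSign f g := by
  have h0 : Finset.Ioi (0 : Fin 7) = {1, 2, 3, 4, 5, 6} := by decide
  have h1 : Finset.Ioi (1 : Fin 7) = {2, 3, 4, 5, 6} := by decide
  have h2 : Finset.Ioi (2 : Fin 7) = {3, 4, 5, 6} := by decide
  have h3 : Finset.Ioi (3 : Fin 7) = {4, 5, 6} := by decide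
  have h4 : Finset.Ioi (4 : Fin 7) = {5, 6} := by decide
  have h5 : Finset.Ioi (5 : Fin 7) = {6} := by decide
  have h6 : Finset.Ioi (6 : Fin 7) = ∅ := by decide
  simp only [lc, Fin.prod_univ_seven, h0, h1, h2, h3, h4, h5, h6]
  repeat rw [Finset.prod_insert (by decide)]
  simp only [Finset.prod_singleton, Finset.prod_empty]
  have e0 : (![a, b, c, d, e, f, g] : Fin 7 → Fin 7) 0 = a := rfl
  have e1 : (![a, b, c, d, e, f, g] : Fin 7 → Fin 7) 1 = b := rfl
  have e2 : (![a, b, c, d, e, f, g] : Fin 7 → Fin 7) 2 = c := rfl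
  have e3 : (![a, b, c, d, e, f, g] : Fin 7 → Fin 7) 3 = d := rfl
  have e4 : (![a, b, c, d, e, f, g] : Fin 7 → Fin 7) 4 = e := rfl
  have e5 : (![a, b, c, d, e, f, g] : Fin 7 → Fin 7) 5 = f := rfl
  have e6 : (![a, b, c, d, e, f, g] : Fin 7 → Fin 7) 6 = g := rfl
  simp only [e0, e1, e2, e3, e4, e5, e6]
  ring

theorem contr_sum (i j : Fin 7) : (contr i j : ℝ) = ∑ s : Fin 7 → Fin 7,
    (eps i (s 0) (s 1) : ℝ) * (eps j (s 2) (s 3) : ℝ) * (eps (s 4) (s 5) (s 6) : ℝ) *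
      (lc s : ℝ) := by
  rw [sum_fun7]
  simp only [contr, sum7_eq, lmul_eq, lc_vec]
  push_cast
  simp only [Finset.mul_sum]
  refine Finset.sum_congr rfl fun a _ => ?_
  refine Finset.sum_congr rfl fun b _ => ?_
  refine Finset.sum_congr rfl fun c _ => ?_
  refine Finset.sum_congr rfl fun d _ => ?_
  refine Finset.sum_congr rfl fun e _ => ?_
  refine Finset.sum_congr rfl fun f _ => ?_
  refine Finset.sum_congr rfl fun g _ => ?_
  change _ = (eps i a b : ℝ) * (eps j c d : ℝ) * (eps e f g : ℝ) * _
  ring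

theorem coef_sum (u v : E7) :
    ∑ s : Fin 7 → Fin 7, coef u v s * (lc s : ℝ) = -144 * ⟪u, v⟫ := by
  have h : ∑ s : Fin 7 → Fin 7, coef u v s * (lc s : ℝ)
      = ∑ i, ∑ j, u i * v j * (contr i j : ℝ) := by
    simp only [contr_sum, Finset.mul_sum]
    simp only [Finset.sum_comm (s := (Finset.univ : Finset (Fin 7)))
      (t := (Finset.univ : Finset (Fin 7 → Fin 7)))]
    refine Finset.sum_congr rfl fun s _ => ?_
    simp only [coef]
    rw [Finset.sum_mul_sum, Finset.sum_mul, Finset.sum_mul]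
    refine Finset.sum_congr rfl fun i _ => ?_
    rw [Finset.sum_mul, Finset.sum_mul]
    refine Finset.sum_congr rfl fun j _ => ?_
    ring
  rw [h]
  simp only [contr_eq, PiLp.inner_apply, Finset.mul_sum]
  refine Finset.sum_congr rfl fun i _ => ?_
  simp
  ring

theorem key (A : E7 →ₗ[ℝ] E7)
    (hA : ∀ x y z : E7, phi (A x) (A y) (A z) = phi x y z) (u v : E7) :
    ⟪A u, A v⟫ * LinearMap.det A = ⟪u, v⟫ := by
  let b := EuclideanSpace.basisFun (Fin 7) ℝ
  let W : Matrix (Fin 7) (Fin 7) ℝ := LinearMap.toMatrix b.toBasis b.toBasis A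
  have hW : ∀ i j, W i j = A (b j) i := by
    intro i j
    simp [W, b, LinearMap.toMatrix_apply]
  have h1 := alt_sum W (coef (A u) (A v))
  have h2 := alt_sum (1 : Matrix (Fin 7) (Fin 7) ℝ) (coef u v)
  have h3 : ∀ σ : Equiv.Perm (Fin 7),
      ∑ s : Fin 7 → Fin 7, coef (A u) (A v) s * ∏ k, W (s k) (σ k)
      = ∑ s : Fin 7 → Fin 7, coef u v s * ∏ k, (1 : Matrix (Fin 7) (Fin 7) ℝ) (s k) (σ k) := by
    intro σ
    have e1 := prod_phi (A u) (A v) (fun k => A (b (σ k)))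
    have e2 := prod_phi u v (fun k => b (σ k))
    simp only [hA] at e1
    simp only [hW]
    rw [← e1, e2]
    refine Finset.sum_congr rfl fun s _ => ?_
    congr 1
    refine Finset.prod_congr rfl fun k _ => ?_
    simp [b, Matrix.one_apply]
  simp only [h3] at h1
  rw [h1, coef_sum, coef_sum, Matrix.det_one] at h2
  have h4 : W.det = LinearMap.det A := LinearMap.det_toMatrix b.toBasis A
  rw [h4] at h2
  linarith

/-- any linear map preserving the associative 3-form φ₀ is a special
orthogonal transformation (G₂ ⊂ SO(7)). -/
theorem stabilizer_of_phi_in_SO7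
    (A : E7 →ₗ[ℝ] E7)
    (hA : ∀ x y z : E7, phi (A x) (A y) (A z) = phi x y z) :
    (∀ x y : E7, ⟪A x, A y⟫ = ⟪x, y⟫) ∧ LinearMap.det A = 1 := by
  have hk := key A hA
  have hdet : LinearMap.det A = 1 := by
    let b := EuclideanSpace.basisFun (Fin 7) ℝ
    let W : Matrix (Fin 7) (Fin 7) ℝ := LinearMap.toMatrix b.toBasis b.toBasis A
    have hW : ∀ i j, W i j = A (b j) i := by
      intro i j
      simp [W, b, LinearMap.toMatrix_apply]
    have h4 : W.det = LinearMap.det A := LinearMap.det_toMatrix b.toBasis A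
    have h5 : W.det • (W.transpose * W) = 1 := by
      ext i j
      have h := hk (b j) (b i)
      rw [OrthonormalBasis.inner_eq_ite, PiLp.inner_apply] at h
      simp only [Matrix.smul_apply, Matrix.mul_apply, Matrix.transpose_apply, hW, h4,
        Matrix.one_apply, smul_eq_mul]
      rw [mul_comm]
      simpa [eq_comm] using h
    have h6 := congrArg Matrix.det h5
    rw [Matrix.det_smul, Matrix.det_mul, Matrix.det_transpose, Matrix.det_one,
      Fintype.card_fin] at h6
    have h7 : W.det ^ 9 = 1 ^ 9 := by rw [one_pow, ← h6]; ring
    rw [← h4]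
    exact (Odd.strictMono_pow (by decide : Odd 9)).injective h7
  refine ⟨fun x y => ?_, hdet⟩
  have h := hk x y
  rwa [hdet, mul_one] at h
end
end
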